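/- For every integer r ≥ 2 there exist constants c > 0, c₁ > 0, c₂ > 0 and N₀ such that for every integer N > N₀ there exists an r-uniform hypergraph H on N vertices with c₁·N^{(r+1)/2}·√(log N) ≤ |E(H)| ≤ c₂·N^{(r+1)/2}·√(log N) and s(H) ≥ c·N^r. -/

import Mathlib

/-- A labeling of the vertices of a hypergraph with hyperedge set `E` by positive integers is
sum-distinguishing if distinct hyperedges receive distinct sums of labels. -/
def SumDistinguishing {V : Type*} (E : Finset (Finset V)) (f : V → ℕ) : Prop :=
  (∀ v, 1 ≤ f v) ∧ ∀ e ∈ E, ∀ e' ∈ E, e ≠ e' → ∑ v ∈ e, f v ≠ ∑ v ∈ e', f v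

/-- `hs E` is the smallest `N` such that the hypergraph with hyperedge set `E` has a
sum-distinguishing labeling with all labels at most `N`. -/
noncomputable def hs {V : Type*} (E : Finset (Finset V)) : ℕ :=
  sInf {N | ∃ f : V → ℕ, SumDistinguishing E f ∧ ∀ v, f v ≤ N}

/-- Among at least `2 * M + S - 1` points with values below `S`, one can choose `M` disjoint
pairs such that the two points of each pair take the same value. -/
theorem exists_monochromatic_pairs {X : Type*} [DecidableEq X] (σ : X → ℕ) (S : ℕ)
    (hσ : ∀ x, σ x < S) (M : ℕ) (s : Finset X) (hs : 2 * M + S ≤ s.card + 1) :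
    ∃ a b : Fin M → X, Function.Injective (Sum.elim a b) ∧
      ∀ i, a i ∈ s ∧ b i ∈ s ∧ σ (a i) = σ (b i) := by
  induction M generalizing s with
  | zero => exact ⟨Fin.elim0, Fin.elim0, fun x => by rcases x with x | x <;> exact x.elim0,
      fun i => i.elim0⟩
  | succ M ih =>
    obtain ⟨x, hx, y, hy, hxy, hσxy⟩ :=
      Finset.exists_ne_map_eq_of_card_lt_of_maps_to (s := s) (t := Finset.range S) (f := σ)
        (by rw [Finset.card_range]; omega) (fun x _ => by simpa using hσ x)
    have hcard : ((s.erase x).erase y).card = s.card - 2 := by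
      rw [Finset.card_erase_of_mem (Finset.mem_erase.2 ⟨hxy.symm, hy⟩),
        Finset.card_erase_of_mem hx]
      omega
    obtain ⟨a, b, hinj, hab⟩ := ih ((s.erase x).erase y) (by omega)
    have ha : ∀ i, a i ≠ x ∧ a i ≠ y ∧ a i ∈ s := fun i => by
      have := (hab i).1; simp only [Finset.mem_erase] at this; tauto
    have hb : ∀ i, b i ≠ x ∧ b i ≠ y ∧ b i ∈ s := fun i => by
      have := (hab i).2.1; simp only [Finset.mem_erase] at this; tauto
    refine ⟨Fin.cons x a, Fin.cons y b, ?_, Fin.cases ⟨hx, hy, hσxy⟩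
      fun i => ⟨(ha i).2.2, (hb i).2.2, (hab i).2.2⟩⟩
    rw [Sum.elim_injective] at hinj ⊢
    refine ⟨Fin.cons_injective_iff.2 ⟨?_, hinj.1⟩, Fin.cons_injective_iff.2 ⟨?_, hinj.2.1⟩, ?_⟩
    · rintro ⟨i, hi⟩; exact (ha i).1 hi
    · rintro ⟨i, hi⟩; exact (hb i).2.1 hi
    · refine Fin.cases (Fin.cases hxy fun j => (hb j).1.symm) fun i =>
        Fin.cases (ha i).2.1 fun j => hinj.2.2 i j

/-- The number of `k`-colourings of `X` in which none of `M` given disjoint pairs has both its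
points of the colour `j`. -/
theorem card_colorings_avoiding_pairs_le {X : Type*} [Fintype X] [DecidableEq X] {M k : ℕ}
    (a b : Fin M → X) (hab : Function.Injective (Sum.elim a b)) (j : Fin k) :
    (Finset.univ.filter fun φ : X → Fin k => ∀ i, ¬ (φ (a i) = j ∧ φ (b i) = j)).card ≤
      (k ^ 2 - 1) ^ M * k ^ (Fintype.card X - 2 * M) := by
  classical
  let T := {x : X // x ∉ Set.range (Sum.elim a b)}
  have hT : Fintype.card T = Fintype.card X - 2 * M := by
    have h := Fintype.card_subtype_compl fun x => x ∈ Set.range (Sum.elim a b)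
    have h' := Fintype.card_congr (Equiv.ofInjective _ hab)
    simp only [Fintype.card_sum, Fintype.card_fin] at h'
    rw [h, two_mul, h']
  let Q := {q : Fin k × Fin k // q ≠ (j, j)}
  have hQ : Fintype.card Q = k ^ 2 - 1 := by
    simp [Q, Fintype.card_subtype_compl, sq]
  let F : {φ : X → Fin k // ∀ i, ¬ (φ (a i) = j ∧ φ (b i) = j)} → (Fin M → Q) × (T → Fin k) :=
    fun φ => (fun i => ⟨(φ.1 (a i), φ.1 (b i)), fun h => φ.2 i (Prod.mk.inj h)⟩, fun x => φ.1 x)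
  have hF : Function.Injective F := by
    intro φ ψ h
    obtain ⟨h₁, h₂⟩ := Prod.mk.inj h
    ext1; funext x
    by_cases hx : x ∈ Set.range (Sum.elim a b)
    · obtain ⟨i | i, rfl⟩ := hx
      · exact (Prod.mk.inj (Subtype.mk.inj (congrFun h₁ i))).1
      · exact (Prod.mk.inj (Subtype.mk.inj (congrFun h₁ i))).2
    · exact congrFun h₂ ⟨x, hx⟩
  have := Fintype.card_le_of_injective F hF
  rw [Fintype.card_subtype] at this
  simpa [hT, hQ] using this

/-- If there are few functions in the family `σ`, then some small subset of `X` contains, for each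
of them, two distinct points with the same value. -/
theorem exists_small_set_with_collisions {X ι : Type*} [Fintype X] [DecidableEq X] [Fintype ι]
    (σ : ι → X → ℕ) (S M k : ℕ) (hk : 0 < k) (hσ : ∀ f x, σ f x < S)
    (hM : 2 * M + S ≤ Fintype.card X + 1)
    (hlt : k * Fintype.card ι * ((k ^ 2 - 1) ^ M * k ^ (Fintype.card X - 2 * M)) <
      k ^ Fintype.card X) :
    ∃ E : Finset X, E.card ≤ Fintype.card X / k ∧
      ∀ f, ∃ x ∈ E, ∃ y ∈ E, x ≠ y ∧ σ f x = σ f y := by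
  classical
  have : Nonempty (Fin k) := ⟨⟨0, hk⟩⟩
  choose a b hinj hab using fun f => exists_monochromatic_pairs (σ f) S (hσ f) M Finset.univ hM
  let bad : Fin k × ι → Finset (X → Fin k) := fun p =>
    Finset.univ.filter fun φ => ∀ i, ¬ (φ (a p.2 i) = p.1 ∧ φ (b p.2 i) = p.1)
  have hbad : (Finset.univ.biUnion bad).card < (Finset.univ : Finset (X → Fin k)).card := by
    calc (Finset.univ.biUnion bad).card
        ≤ (Finset.univ : Finset (Fin k × ι)).card *
          ((k ^ 2 - 1) ^ M * k ^ (Fintype.card X - 2 * M)) :=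
          Finset.card_biUnion_le_card_mul _ _ _ fun p _ =>
            card_colorings_avoiding_pairs_le _ _ (hinj p.2) p.1
      _ < _ := by simpa using hlt
  obtain ⟨φ, -, hφ⟩ := Finset.exists_mem_notMem_of_card_lt_card hbad
  obtain ⟨j, hj⟩ := Fintype.exists_card_fiber_lt_of_card_lt_mul (f := φ)
    (n := Fintype.card X / k + 1)
    (by rw [Fintype.card_fin]; exact Nat.lt_mul_div_succ _ hk)
  refine ⟨Finset.univ.filter fun x => φ x = j, Nat.lt_succ_iff.1 hj, fun f => ?_⟩
  simp only [bad, Finset.mem_biUnion, Finset.mem_filter, Finset.mem_univ, true_and, not_exists,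
    not_forall, not_not] at hφ
  obtain ⟨i, h₁, h₂⟩ := hφ (j, f)
  refine ⟨a f i, by simpa using h₁, b f i, by simpa using h₂, fun h => ?_, (hab f i).2.2⟩
  exact Sum.inl_ne_inr (hinj f (a₁ := .inl i) (a₂ := .inr i) h)

/-- Every edge set has a sum-distinguishing labeling with bounded labels. -/
theorem exists_sumDistinguishing_le {N : ℕ} (E : Finset (Finset (Fin N))) :
    ∃ L, ∃ f : Fin N → ℕ, SumDistinguishing E f ∧ ∀ v, f v ≤ L := by
  refine ⟨2 ^ N, fun v => 2 ^ (v : ℕ), ⟨fun v => Nat.one_le_two_pow, fun e _ e' _ hne h => ?_⟩,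
    fun v => Nat.pow_le_pow_right (by norm_num) v.is_lt.le⟩
  apply hne
  have key : ∀ s : Finset (Fin N),
      ∑ v ∈ s, 2 ^ (v : ℕ) = ∑ i ∈ s.map Fin.valEmbedding, 2 ^ i := fun s => by simp
  rw [key, key] at h
  exact Finset.map_injective _ (Finset.geomSum_injective le_rfl h)

/-- A sufficient counting condition for an `r`-uniform hypergraph on `N` vertices with
`N.choose r / k` edges not to have a sum-distinguishing labeling with labels at most `L`. -/
theorem exists_uniform_lt_hs (N r L M k : ℕ) (hk : 0 < k)
    (hM : 2 * M + (r * L + 1) ≤ N.choose r + 1)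
    (hlt : k * (L + 1) ^ N * ((k ^ 2 - 1) ^ M * k ^ (N.choose r - 2 * M)) < k ^ N.choose r) :
    ∃ E : Finset (Finset (Fin N)), (∀ e ∈ E, e.card = r) ∧ E.card = N.choose r / k ∧
      L < hs E := by
  have hX : Fintype.card {e : Finset (Fin N) // e.card = r} = N.choose r := by simp
  obtain ⟨E₀, hE₀, hcoll⟩ := exists_small_set_with_collisions
    (X := {e : Finset (Fin N) // e.card = r})
    (fun (f : Fin N → Fin (L + 1)) e => ∑ v ∈ e.1, (f v : ℕ)) (r * L + 1) M k hk
    (fun f e => Nat.lt_succ_iff.2 <| by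
      have := Finset.sum_le_card_nsmul e.1 (fun v => (f v : ℕ)) L fun v _ => (f v).is_le
      rwa [e.2, smul_eq_mul] at this)
    (by rwa [hX]) (by rw [hX]; simpa using hlt)
  rw [hX] at hE₀
  obtain ⟨E, hsub, hcard⟩ := Finset.exists_superset_card_eq hE₀
    (by rw [hX]; exact Nat.div_le_self _ _)
  refine ⟨E.map (Function.Embedding.subtype _), ?_, by rw [Finset.card_map, hcard], ?_⟩
  · intro e he
    obtain ⟨x, -, rfl⟩ := Finset.mem_map.1 he
    exact x.2
  · by_contra! hle
    obtain ⟨f, ⟨-, hf⟩, hfle⟩ :=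
      Nat.sInf_mem (exists_sumDistinguishing_le (E.map (Function.Embedding.subtype _)))
    obtain ⟨x, hx, y, hy, hxy, h⟩ :=
      hcoll fun v => ⟨f v, Nat.lt_succ_iff.2 ((hfle v).trans hle)⟩
    exact hf x (Finset.mem_map_of_mem _ (hsub hx)) y (Finset.mem_map_of_mem _ (hsub hy))
      (fun e => hxy (Subtype.ext e)) h

/-- The exponential form of the counting condition. -/
theorem counting_bound_of_log {n M k Q N : ℕ} (hk : 0 < k) (hQ : 0 < Q) (hM : 2 * M ≤ n)
    (h : Real.log k + N * Real.log Q < M / (k : ℝ) ^ 2) :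
    k * Q ^ N * ((k ^ 2 - 1) ^ M * k ^ (n - 2 * M)) < k ^ n := by
  have hk' : (0 : ℝ) < k := by exact_mod_cast hk
  have hQ' : (0 : ℝ) < Q := by exact_mod_cast hQ
  have hk1 : (1 : ℝ) ≤ k := by exact_mod_cast hk
  have hsq : ((k ^ 2 - 1 : ℕ) : ℝ) = k ^ 2 * (1 - 1 / (k : ℝ) ^ 2) := by
    rw [Nat.cast_sub (Nat.one_le_pow _ _ hk)]
    push_cast
    field_simp
  have hle : (1 - 1 / (k : ℝ) ^ 2) ^ M ≤ Real.exp (-(M / (k : ℝ) ^ 2)) := by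
    have h0 : 0 ≤ 1 - 1 / (k : ℝ) ^ 2 := by
      rw [sub_nonneg, div_le_one (by positivity)]
      exact one_le_pow₀ hk1
    calc (1 - 1 / (k : ℝ) ^ 2) ^ M ≤ Real.exp (-(1 / (k : ℝ) ^ 2)) ^ M :=
          pow_le_pow_left₀ h0 (Real.one_sub_le_exp_neg _) _
      _ = Real.exp (-(M / (k : ℝ) ^ 2)) := by
          rw [← Real.exp_nat_mul]; congr 1; ring
  have hlt : (k : ℝ) * Q ^ N * (1 - 1 / (k : ℝ) ^ 2) ^ M < 1 := by
    have hexp : (k : ℝ) * Q ^ N = Real.exp (Real.log k + N * Real.log Q) := by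
      rw [Real.exp_add, Real.exp_log hk', Real.exp_nat_mul, Real.exp_log hQ']
    calc (k : ℝ) * Q ^ N * (1 - 1 / (k : ℝ) ^ 2) ^ M
        ≤ k * Q ^ N * Real.exp (-(M / (k : ℝ) ^ 2)) :=
          mul_le_mul_of_nonneg_left hle (by positivity)
      _ = Real.exp (Real.log k + N * Real.log Q - M / (k : ℝ) ^ 2) := by
          rw [hexp, ← Real.exp_add]; rfl
      _ < 1 := (Real.exp_lt_exp.2 (by linarith)).trans_eq Real.exp_zero
  have hpow : (k : ℝ) ^ n = (k ^ 2) ^ M * k ^ (n - 2 * M) := by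
    rw [← pow_mul, ← pow_add, Nat.add_sub_cancel' hM]
  have : ((k * Q ^ N * ((k ^ 2 - 1) ^ M * k ^ (n - 2 * M)) : ℕ) : ℝ) < ((k ^ n : ℕ) : ℝ) := by
    push_cast [hsq]
    rw [mul_pow, hpow]
    calc (k : ℝ) * Q ^ N * ((k ^ 2) ^ M * (1 - 1 / (k : ℝ) ^ 2) ^ M * k ^ (n - 2 * M))
        = k * Q ^ N * (1 - 1 / (k : ℝ) ^ 2) ^ M * (((k : ℝ) ^ 2) ^ M * k ^ (n - 2 * M)) := by ring
      _ < 1 * (((k : ℝ) ^ 2) ^ M * k ^ (n - 2 * M)) := mul_lt_mul_of_pos_right hlt (by positivity)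
      _ = _ := one_mul _
  exact_mod_cast this

/-- For fixed `r`, the binomial coefficient `N.choose r` has order of magnitude `N ^ r`. -/
theorem exists_pow_le_mul_choose (r : ℕ) :
    ∃ D : ℝ, 1 ≤ D ∧ ∀ N : ℕ, 2 * r ≤ N → (N : ℝ) ^ r ≤ D * N.choose r := by
  refine ⟨2 ^ r * r.factorial, ?_, fun N hN => ?_⟩
  · exact one_le_mul_of_one_le_of_one_le (one_le_pow₀ one_le_two)
      (by exact_mod_cast r.factorial_pos)
  · have h := Nat.pow_le_choose (α := ℝ) r N
    rw [div_le_iff₀ (by positivity)] at h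
    have h2 : (N : ℝ) ≤ 2 * (N + 1 - r : ℕ) := by
      have : N ≤ 2 * (N + 1 - r) := by omega
      exact_mod_cast this
    calc (N : ℝ) ^ r ≤ (2 * (N + 1 - r : ℕ)) ^ r := pow_le_pow_left₀ (by positivity) h2 r
      _ = 2 ^ r * (N + 1 - r : ℕ) ^ r := mul_pow _ _ _
      _ ≤ 2 ^ r * (N.choose r * r.factorial) := mul_le_mul_of_nonneg_left h (by positivity)
      _ = _ := by ring

/-- Lower bound for `n / k` when `n` has order `P * P * x` and `k` has order `P / T`. -/
theorem le_div_of_mul_le {n k : ℕ} {a D P T x : ℝ} (ha0 : 0 < a) (hD0 : 0 < D) (hP0 : 0 < P)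
    (hT0 : 0 < T) (hk0 : 0 < k) (hkn : k ≤ n) (hD' : P * P * x ≤ D * n) (hkT : k * T ≤ a * P) :
    1 / (2 * a * D) * (P * x) * T ≤ (n / k : ℕ) := by
  have h1 : n ≤ 2 * k * (n / k : ℕ) := by
    have h2 := Nat.lt_mul_div_succ n hk0
    have h3 : 1 ≤ n / k := (Nat.one_le_div_iff hk0).2 hkn
    nlinarith
  have h2 : (n : ℝ) ≤ 2 * k * (n / k : ℕ) := by exact_mod_cast h1
  have h3 : P * (P * x * T) ≤ P * (2 * a * D * (n / k : ℕ)) := by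
    calc P * (P * x * T) = P * P * x * T := by ring
      _ ≤ D * (2 * k * (n / k : ℕ)) * T := by
        refine mul_le_mul_of_nonneg_right (hD'.trans ?_) hT0.le
        gcongr
      _ = 2 * D * (n / k : ℕ) * (k * T) := by ring
      _ ≤ 2 * D * (n / k : ℕ) * (a * P) := by gcongr
      _ = _ := by ring
  have h4 := le_of_mul_le_mul_left h3 hP0
  calc 1 / (2 * a * D) * (P * x) * T = P * x * T / (2 * a * D) := by ring
    _ ≤ (n / k : ℕ) := (div_le_iff₀ (by positivity)).2 (by linarith)

/-- Upper bound for `n / k` when `n` has order `P * P * x` and `k` has order `P / T`. -/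
theorem div_le_of_le_mul {n k : ℕ} {a P T x : ℝ} (ha0 : 0 < a) (hP0 : 0 < P) (hT0 : 0 < T)
    (hnx : n ≤ P * P * x) (hkT' : a * P ≤ 2 * (k * T)) :
    ((n / k : ℕ) : ℝ) ≤ 2 / a * (P * x) * T := by
  have h1 : ((n / k : ℕ) : ℝ) * k ≤ n := by
    exact_mod_cast Nat.div_mul_le_self n k
  have h3 : P * (a * (n / k : ℕ)) ≤ P * (2 * (P * x) * T) := by
    calc P * (a * (n / k : ℕ)) = (n / k : ℕ) * (a * P) := by ring
      _ ≤ (n / k : ℕ) * (2 * (k * T)) := by gcongr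
      _ = 2 * T * ((n / k : ℕ) * k) := by ring
      _ ≤ 2 * T * (P * P * x) :=
        mul_le_mul_of_nonneg_left (h1.trans hnx) (by positivity)
      _ = _ := by ring
  have h4 := le_of_mul_le_mul_left h3 hP0
  calc ((n / k : ℕ) : ℝ) ≤ 2 * (P * x) * T / a := (le_div_iff₀ ha0).2 (by linarith)
    _ = _ := by ring

/-- The real parameters `P = N ^ ((r - 1) / 2)` and `T = √(log N)` and their relations, for
large `N`. -/
theorem eventually_exists_scales (r : ℕ) (hr : 2 ≤ r) {a : ℝ} (ha0 : 0 < a) :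
    ∀ᶠ N : ℕ in Filter.atTop, ∃ P : ℝ, 1 ≤ P ∧ 1 ≤ √(Real.log N) ∧ √(Real.log N) ≤ a * P ∧
      P * P * N = (N : ℝ) ^ r ∧ (N : ℝ) ^ (((r : ℝ) + 1) / 2) = P * N := by
  have hr0 : (2 : ℝ) ≤ r := by exact_mod_cast hr
  have h := ((Real.isLittleO_log_id_atTop.bound (pow_pos ha0 2)).and
    (Filter.eventually_ge_atTop (3 : ℝ)))
  filter_upwards [tendsto_natCast_atTop_atTop.eventually h] with N ⟨hlog, hx3⟩
  have hx0 : (0 : ℝ) < N := by linarith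
  have hlog1 : 1 ≤ Real.log N := by
    rw [Real.le_log_iff_exp_le hx0]; linarith [Real.exp_one_lt_d9]
  have hlog' : Real.log N ≤ a ^ 2 * N := by
    simpa [abs_of_nonneg (zero_le_one.trans hlog1)] using hlog
  refine ⟨(N : ℝ) ^ (((r : ℝ) - 1) / 2), Real.one_le_rpow (by linarith) (by linarith),
    Real.one_le_sqrt.2 hlog1, ?_, ?_, ?_⟩
  · calc √(Real.log N) ≤ √(a ^ 2 * N) := Real.sqrt_le_sqrt hlog'
      _ = a * √N := by rw [Real.sqrt_mul (sq_nonneg a), Real.sqrt_sq ha0.le]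
      _ ≤ _ := by
        rw [Real.sqrt_eq_rpow]
        exact mul_le_mul_of_nonneg_left
          (Real.rpow_le_rpow_of_exponent_le (by linarith) (by linarith)) ha0.le
  · rw [← Real.rpow_add hx0, ← Real.rpow_add_one hx0.ne', ← Real.rpow_natCast]
    congr 1; ring
  · rw [← Real.rpow_add_one hx0.ne']; congr 1; ring

/-- A positive integer of order `a * P / T`. -/
theorem exists_nat_mul_le {a P T : ℝ} (hT0 : 0 < T) (hTP : T ≤ a * P) :
    ∃ k : ℕ, 0 < k ∧ k * T ≤ a * P ∧ a * P ≤ 2 * (k * T) := by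
  have hy1 : 1 ≤ a * P / T := (one_le_div hT0).2 hTP
  have hk0 : 0 < ⌊a * P / T⌋₊ := Nat.floor_pos.2 hy1
  have hk1 : (1 : ℝ) ≤ ⌊a * P / T⌋₊ := by exact_mod_cast hk0
  refine ⟨⌊a * P / T⌋₊, hk0, ?_, ?_⟩
  · rw [← le_div_iff₀ hT0]; exact Nat.floor_le (by linarith)
  · have := Nat.lt_floor_add_one (a * P / T)
    rw [div_lt_iff₀ hT0] at this
    nlinarith

/-- For every `r ≥ 2` there exist constants `c, c₁, c₂ > 0` and `N₀` such that for every
`N > N₀` there is an `r`-uniform hypergraph `H` on `N` vertices with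
`c₁·N^((r+1)/2)·√(log N) ≤ |E(H)| ≤ c₂·N^((r+1)/2)·√(log N)` and `s(H) ≥ c·N^r`. -/
theorem stmt13 (r : ℕ) (hr : 2 ≤ r) :
    ∃ c c₁ c₂ : ℝ, 0 < c ∧ 0 < c₁ ∧ 0 < c₂ ∧ ∃ N₀ : ℕ, ∀ N : ℕ, N₀ < N →
      ∃ E : Finset (Finset (Fin N)),
        (∀ e ∈ E, e.card = r) ∧
        c₁ * (N : ℝ) ^ (((r : ℝ) + 1) / 2) * Real.sqrt (Real.log N) ≤ (E.card : ℝ) ∧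
        (E.card : ℝ) ≤ c₂ * (N : ℝ) ^ (((r : ℝ) + 1) / 2) * Real.sqrt (Real.log N) ∧
        c * (N : ℝ) ^ r ≤ (hs E : ℝ) := by
  have hr0 : (2 : ℝ) ≤ r := by exact_mod_cast hr
  obtain ⟨D, hD1, hD⟩ := exists_pow_le_mul_choose r
  obtain ⟨a, ha⟩ : ∃ a : ℝ, a = 1 / (24 * r * D) := ⟨_, rfl⟩
  have ha0 : 0 < a := by rw [ha]; positivity
  have harD : a * r * D = 1 / 24 := by rw [ha]; field_simp
  have haD : a * D ≤ 1 / 24 := by nlinarith [mul_pos ha0 (zero_lt_one.trans_le hD1)]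
  have ha1 : a ≤ 1 := by nlinarith
  refine ⟨1 / (4 * r * D), 1 / (2 * a * D), 2 / a, by positivity, by positivity, by positivity, ?_⟩
  obtain ⟨N₀, hN₀⟩ := Filter.eventually_atTop.1 ((eventually_exists_scales r hr ha0).and
    ((Filter.eventually_ge_atTop (2 * r)).and (Filter.eventually_ge_atTop ⌈8 * D⌉₊)))
  refine ⟨N₀, fun N hN => ?_⟩
  obtain ⟨⟨P, hP1, hT1, hTP, hPP, hPx⟩, h2r, h8⟩ := hN₀ N hN.le
  obtain ⟨x, hx⟩ : ∃ x : ℝ, x = N := ⟨_, rfl⟩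
  have hD' := hD N h2r
  have hx8 : 8 * D ≤ x := hx ▸ (Nat.le_ceil _).trans (by exact_mod_cast h8)
  have hnx : ((N.choose r : ℕ) : ℝ) ≤ x ^ r := by
    rw [hx]; exact_mod_cast Nat.choose_le_pow N r
  rw [← hx] at hT1 hTP hPP hPx hD' ⊢
  obtain ⟨n, hn⟩ : ∃ n, n = N.choose r := ⟨_, rfl⟩
  rw [← hn] at hD' hnx
  have hx0 : 0 < x := by linarith
  have hxr : x ≤ x ^ r := le_self_pow₀ (by linarith) (by omega)
  have hn8 : 8 ≤ (n : ℝ) :=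
    le_of_mul_le_mul_left (a := D) (by linarith) (by linarith)
  obtain ⟨T, hT⟩ : ∃ T : ℝ, T = √(Real.log x) := ⟨_, rfl⟩
  rw [← hT] at hT1 hTP
  have hTT : T * T = Real.log x := hT ▸ Real.mul_self_sqrt (Real.log_nonneg (by linarith))
  rw [hPx, ← hT]
  have hT0 : 0 < T := by linarith
  have hP0 : 0 < P := by linarith
  have hPxr : P ≤ x ^ r := by
    rw [← hPP, mul_assoc]
    exact le_mul_of_one_le_right hP0.le (one_le_mul_of_one_le_of_one_le hP1 (by linarith))
  obtain ⟨k, hk0, hkT, hkT'⟩ := exists_nat_mul_le hT0 hTP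
  have hkP : (k : ℝ) ≤ a * P := (le_mul_of_one_le_right k.cast_nonneg hT1).trans hkT
  obtain ⟨L, hL⟩ : ∃ L : ℕ, L = ⌊1 / (4 * r * D) * x ^ r⌋₊ := ⟨_, rfl⟩
  have hLle : (L : ℝ) ≤ 1 / (4 * r * D) * x ^ r := hL ▸ Nat.floor_le (by positivity)
  have hrL : 4 * (r * L) ≤ n := by
    have : (4 : ℝ) * (r * L) ≤ n := by
      calc (4 : ℝ) * (r * L) ≤ 4 * (r * (1 / (4 * r * D) * x ^ r)) := by gcongr
        _ = x ^ r / D := by field_simp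
        _ ≤ n := (div_le_iff₀ (by linarith)).2 (by linarith)
    exact_mod_cast this
  have hkn : k ≤ n := by
    have : (k : ℝ) ≤ n := by
      calc (k : ℝ) ≤ a * P := hkP
        _ ≤ a * (D * n) := mul_le_mul_of_nonneg_left (hPxr.trans hD') ha0.le
        _ = a * D * n := by ring
        _ ≤ n := mul_le_of_le_one_left n.cast_nonneg (by linarith)
    exact_mod_cast this
  have hM8 : (n : ℝ) ≤ 8 * (n / 4 : ℕ) := by
    have h8n : 8 ≤ n := by exact_mod_cast hn8
    have : n ≤ 8 * (n / 4) := by omega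
    exact_mod_cast this
  have hlogxr : Real.log (x ^ r) = r * (T * T) := by rw [Real.log_pow, hTT]
  have hlogk : Real.log k ≤ r * (T * T) :=
    hlogxr ▸ Real.log_le_log (by exact_mod_cast hk0)
      (hkP.trans ((mul_le_of_le_one_left hP0.le ha1).trans hPxr))
  have hlogL : Real.log ((L + 1 : ℕ) : ℝ) ≤ r * (T * T) := by
    rw [← hlogxr]
    refine Real.log_le_log (by positivity) ?_
    have h1 : (4 : ℝ) * (r * L) ≤ n := by exact_mod_cast hrL
    have h2 : (L : ℝ) ≤ r * L := le_mul_of_one_le_left L.cast_nonneg (by linarith)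
    push_cast
    linarith
  have hsmall : 3 * (r * (T * T)) * x * k ^ 2 ≤ (n / 4 : ℕ) := by
    have h1 : (k * T) * (k * T) ≤ (a * P) * (a * P) :=
      mul_self_le_mul_self (by positivity) hkT
    calc 3 * (r * (T * T)) * x * k ^ 2 = 3 * r * x * ((k * T) * (k * T)) := by ring
      _ ≤ 3 * r * x * ((a * P) * (a * P)) := by gcongr
      _ = 3 * a * (a * r) * x ^ r := by rw [← hPP]; ring
      _ ≤ 3 * a * (a * r) * (D * n) := by gcongr
      _ = 3 * a * (a * r * D) * n := by ring
      _ = a * (n / 8) := by rw [harD]; ring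
      _ ≤ 1 * (n / 8) := by gcongr
      _ ≤ (n / 4 : ℕ) := by linarith
  have hcount := counting_bound_of_log (n := n) (M := n / 4) (k := k) (Q := L + 1) (N := N) hk0
    L.succ_pos (by omega) <| by
      rw [lt_div_iff₀ (by positivity), ← hx]
      refine lt_of_lt_of_le (mul_lt_mul_of_pos_right ?_ (by positivity)) hsmall
      have hpos : 0 < r * (T * T) := by positivity
      have h1 := mul_le_mul_of_nonneg_left hlogL hx0.le
      have h2 := mul_le_mul_of_nonneg_left (show 1 ≤ x by linarith) hpos.le
      linarith [mul_pos hpos hx0]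
  obtain ⟨E, hE, hcard, hhs⟩ := exists_uniform_lt_hs N r L (n / 4) k hk0
    (by rw [← hn]; omega) (by rw [← hn]; exact hcount)
  rw [← hn] at hcard
  refine ⟨E, hE, ?_, ?_, ?_⟩
  · rw [hcard]
    exact le_div_of_mul_le ha0 (by linarith) hP0 hT0 hk0 hkn (hPP ▸ hD') hkT
  · rw [hcard]
    exact div_le_of_le_mul ha0 hP0 hT0 (hPP ▸ hnx) hkT'
  · have h1 : 1 / (4 * r * D) * x ^ r < L + 1 := hL ▸ Nat.lt_floor_add_one _
    have h2 : (L : ℝ) + 1 ≤ hs E := by exact_mod_cast hhs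
    linarith
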